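/- Let G be a group, H a subgroup of G of index 2, k a field, ξ : H → kˣ a group homomorphism, and g ∈ G ∖ H. Then the restriction to H of the induced representation Ind_H^G ξ is isomorphic, as a representation of H, to the direct sum of the one-dimensional representations ξ and ξ^g, where ξ^g(h) = ξ(g h g⁻¹). -/

import Mathlib

section IndDef

variable {G : Type*} [Group G] (H : Subgroup G) (k : Type*) [Field k] (ξ : H →* kˣ)

/-- The space of the induced representation of the character `ξ` from `H` to `G`:
functions `f : G → k` with `f (h * g) = ξ h * f g`. -/
def indCar : Submodule k (G → k) where
  carrier := {f | ∀ (h : H) (g : G), f (↑h * g) = (ξ h : k) * f g}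
  add_mem' := by
    intro a b ha hb h g
    simp only [Set.mem_setOf_eq, Pi.add_apply] at *
    rw [ha h g, hb h g]; ring
  zero_mem' := by intro h g; simp
  smul_mem' := by
    intro c f hf h g
    simp only [Set.mem_setOf_eq, Pi.smul_apply, smul_eq_mul] at *
    rw [hf h g]; ring

/-- The induced representation `Ind_H^G ξ`, with `G` acting by right translation:
`(g • f) x = f (x * g)`. -/
def indRep : Representation k G (indCar H k ξ) where
  toFun g :=
    { toFun := fun f => ⟨fun x => (f : G → k) (x * g), by
        intro h x
        simpa [mul_assoc] using f.2 h (x * g)⟩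
      map_add' := by intro f₁ f₂; apply Subtype.ext; funext x; simp
      map_smul' := by intro c f; apply Subtype.ext; funext x; simp }
  map_one' := by
    apply LinearMap.ext; intro f; apply Subtype.ext; funext x; simp
  map_mul' := by
    intro g₁ g₂
    apply LinearMap.ext; intro f; apply Subtype.ext; funext x
    simp [mul_assoc]

/-- Isomorphism of representations. -/
def RepIso {M : Type*} [Monoid M] {k : Type*} [CommSemiring k] {V W : Type*}
    [AddCommMonoid V] [Module k V] [AddCommMonoid W] [Module k W]
    (ρ : Representation k M V) (τ : Representation k M W) : Prop :=
  ∃ e : V ≃ₗ[k] W, ∀ (g : M) (v : V), e (ρ g v) = τ g (e v)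

/-- Irreducibility of a representation: the space is nonzero and the only invariant
subspaces are `⊥` and `⊤`. -/
def IsIrredRep {M : Type*} [Monoid M] {k : Type*} [CommSemiring k] {V : Type*}
    [AddCommMonoid V] [Module k V] (ρ : Representation k M V) : Prop :=
  Nontrivial V ∧ ∀ W : Submodule k V, (∀ g : M, ∀ v ∈ W, ρ g v ∈ W) → W = ⊥ ∨ W = ⊤

/-- The conjugate character `ξ^g : h ↦ ξ (g * h * g⁻¹)` of a normal subgroup. -/
def conjChar [H.Normal] (g : G) : H →* kˣ :=
  ξ.comp (MulAut.conjNormal g).toMonoidHom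

theorem conjChar_apply [H.Normal] (g : G) (h : H)
    (hm : g * ↑h * g⁻¹ ∈ H) : conjChar H k ξ g h = ξ ⟨g * ↑h * g⁻¹, hm⟩ := by
  have h1 : (MulAut.conjNormal g h : H) = ⟨g * ↑h * g⁻¹, hm⟩ := by
    ext; simp
  show ξ (MulAut.conjNormal g h) = _
  rw [h1]

end IndDef

section Evaluation

variable {G : Type*} [Group G] (H : Subgroup G) (k : Type*) [Field k] (ξ : H →* kˣ)

/-- Evaluation of an induced function at `1` and at `g`. -/
def indEval (g : G) : indCar H k ξ →ₗ[k] k × k :=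
  ((LinearMap.proj 1).prod (LinearMap.proj g)).comp (indCar H k ξ).subtype

theorem indEval_apply (g : G) (f : indCar H k ξ) :
    indEval H k ξ g f = ((f : G → k) 1, (f : G → k) g) := rfl

variable {H k ξ}

theorem indCar_apply_mul {x : G} (hx : x ∈ H) (f : indCar H k ξ) (y : G) :
    (f : G → k) (x * y) = (ξ ⟨x, hx⟩ : k) * (f : G → k) y :=
  f.2 ⟨x, hx⟩ y

theorem indCar_apply_of_mem {x : G} (hx : x ∈ H) (f : indCar H k ξ) :
    (f : G → k) x = (ξ ⟨x, hx⟩ : k) * (f : G → k) 1 := by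
  simpa using indCar_apply_mul hx f 1

theorem indCar_apply_of_mul_inv_mem {x g : G} (hx : x * g⁻¹ ∈ H) (f : indCar H k ξ) :
    (f : G → k) x = (ξ ⟨x * g⁻¹, hx⟩ : k) * (f : G → k) g := by
  simpa using indCar_apply_mul hx f g

theorem mul_inv_mem_of_index_two (hidx : H.index = 2) {x g : G} (hg : g ∉ H) (hx : x ∉ H) :
    x * g⁻¹ ∈ H := by
  rw [Subgroup.mul_mem_iff_of_index_two hidx, inv_mem_iff]
  exact iff_of_false hx hg

theorem indEval_injective (hidx : H.index = 2) {g : G} (hg : g ∉ H) :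
    Function.Injective (indEval H k ξ g) := by
  intro f₁ f₂ h
  obtain ⟨h₁, h₂⟩ := Prod.ext_iff.mp h
  simp only [indEval_apply] at h₁ h₂
  ext x
  by_cases hx : x ∈ H
  · rw [indCar_apply_of_mem hx, indCar_apply_of_mem hx, h₁]
  · have hx' := mul_inv_mem_of_index_two hidx hg hx
    rw [indCar_apply_of_mul_inv_mem hx', indCar_apply_of_mul_inv_mem hx', h₂]

open Classical in
theorem indEval_surjective (hidx : H.index = 2) {g : G} (hg : g ∉ H) :
    Function.Surjective (indEval H k ξ g) := by
  rintro ⟨a, b⟩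
  refine ⟨⟨fun x => if hx : x ∈ H then (ξ ⟨x, hx⟩ : k) * a
    else (ξ ⟨x * g⁻¹, mul_inv_mem_of_index_two hidx hg hx⟩ : k) * b, ?_⟩, ?_⟩
  · intro h x
    by_cases hx : x ∈ H
    · have hhx : (h : G) * x ∈ H := H.mul_mem h.2 hx
      have hmul : (⟨h * x, hhx⟩ : H) = h * ⟨x, hx⟩ := rfl
      simp only [hx, hhx, dite_true, hmul, map_mul, Units.val_mul, mul_assoc]
    · have hhx : (h : G) * x ∉ H := fun hm => hx ((H.mul_mem_cancel_left h.2).mp hm)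
      have hx' := mul_inv_mem_of_index_two hidx hg hx
      have hmul : (⟨h * x * g⁻¹, mul_inv_mem_of_index_two hidx hg hhx⟩ : H) =
          h * ⟨x * g⁻¹, hx'⟩ := Subtype.ext (mul_assoc _ _ _)
      simp only [hx, hhx, dite_false, hmul, map_mul, Units.val_mul]
      exact mul_assoc _ _ _
  · have hone : (⟨1, H.one_mem⟩ : H) = 1 := rfl
    have hgg : (⟨g * g⁻¹, mul_inv_mem_of_index_two hidx hg hg⟩ : H) = 1 :=
      Subtype.ext (mul_inv_cancel g)
    simp only [indEval_apply, H.one_mem, hg, dite_true, dite_false, hone, hgg, map_one,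
      Units.val_one, one_mul]

theorem indEval_indRep [hN : H.Normal] (g : G) (h : H) (f : indCar H k ξ) :
    indEval H k ξ g (indRep H k ξ h f) =
      ((ξ h : k) * (indEval H k ξ g f).1, (conjChar H k ξ g h : k) * (indEval H k ξ g f).2) := by
  have hm : g * h * g⁻¹ ∈ H := hN.conj_mem h h.2 g
  rw [conjChar_apply H k ξ g h hm]
  refine Prod.ext ?_ (indCar_apply_of_mul_inv_mem hm f)
  change (f : G → k) (1 * h) = _
  rw [one_mul]
  exact indCar_apply_of_mem h.2 f

end Evaluation

/-- Let `H` be an index-2 (hence normal) subgroup of `G`, `k` a field, `ξ : H → kˣ` a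
character and `g ∈ G ∖ H`.  The restriction to `H` of `Ind_H^G ξ` is isomorphic, as a
representation of `H`, to the direct sum of the characters `ξ` and `ξ^g`. -/
theorem stmt4 {G : Type*} [Group G] (H : Subgroup G) [hN : H.Normal] (hidx : H.index = 2)
    (k : Type*) [Field k] (ξ : H →* kˣ) (g : G) (hg : g ∉ H) :
    ∃ e : indCar H k ξ ≃ₗ[k] k × k,
      ∀ (h : H) (f : indCar H k ξ),
        e (indRep H k ξ ↑h f) =
          ((ξ h : k) * (e f).1, (conjChar H k ξ g h : k) * (e f).2) := by
  exact ⟨LinearEquiv.ofBijective (indEval H k ξ g)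
    ⟨indEval_injective hidx hg, indEval_surjective hidx hg⟩, indEval_indRep g⟩
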